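/- arXiv:2412.07058 — 2 statements merged into one kernel-verified Lean document; each statement's English description precedes it below -/
import Mathlib

section
/- Let n be an even positive integer and let L, R ⊆ {1,…,n} be disjoint subsets with |L| ≤ n−|L|−|R| and |R| ≤ n−|L|−|R|. Then for M a uniformly random perfect matching of {1,…,n}: E_M[(-1)^{e_M(L,R)}] = Σ_{i=0, i ≡ |L| (mod 2)}^{|L|} K_i^{n−|L|}(|R|) · |L|! · (n−|L|−i−1)!! / ((|L|−i)!! · (n−1)!!), where K_i^N(x) = Σ_{q=0}^{i} (−1)^q · C(x,q) · C(N−x, i−q) is the binary Krawtchouk polynomial of degree i and size N, and !! denotes the double factorial. -/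
open scoped BigOperators

noncomputable section

/-- The perfect matchings of a finite set `V`, encoded as fixed-point-free involutions. -/
def perfectMatchings (V : Type*) [Fintype V] [DecidableEq V] : Finset (Equiv.Perm V) :=
  Finset.univ.filter fun σ => (∀ v, σ (σ v) = v) ∧ ∀ v, σ v ≠ v

/-- `e_M(L,R)`: the number of pairs of the matching `σ` with one endpoint in `L` and the
other in `R` (for disjoint `L`, `R` this is the number of `x ∈ L` with `σ x ∈ R`). -/
def crossCount {V : Type*} [Fintype V] [DecidableEq V] (σ : Equiv.Perm V) (L R : Finset V) : ℕ :=
  (L.filter fun x => σ x ∈ R).card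

/-- The average of `f` over all perfect matchings of `V`, each with equal weight. -/
def matchingAvg (V : Type*) [Fintype V] [DecidableEq V] (f : Equiv.Perm V → ℝ) : ℝ :=
  (∑ σ ∈ perfectMatchings V, f σ) / ((perfectMatchings V).card : ℝ)

/-- The binary Krawtchouk polynomial `K_i^N(x) = Σ_{q=0}^i (-1)^q C(x,q) C(N-x, i-q)`
evaluated at a natural number `x`. -/
def kraw (N i x : ℕ) : ℤ :=
  ∑ q ∈ Finset.range (i + 1), (-1 : ℤ) ^ q * (x.choose q : ℤ) * ((N - x).choose (i - q) : ℤ)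

/-- The involutions of `α` whose set of non-fixed points is `s`, that is, the perfect matchings
of `s`, extended by the identity. -/
def matchingsOn {α : Type*} [Fintype α] [DecidableEq α] (s : Finset α) :
    Finset (Equiv.Perm α) :=
  Finset.univ.filter fun σ => (∀ v, σ (σ v) = v) ∧ ∀ v, v ∈ s ↔ σ v ≠ v

section Matchings

variable {α : Type*} [Fintype α] [DecidableEq α]

theorem mem_matchingsOn {s : Finset α} {σ : Equiv.Perm α} :
    σ ∈ matchingsOn s ↔ (∀ v, σ (σ v) = v) ∧ ∀ v, v ∈ s ↔ σ v ≠ v := by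
  simp [matchingsOn]

theorem perfectMatchings_eq_matchingsOn_univ :
    perfectMatchings α = matchingsOn Finset.univ := by
  ext σ
  simp [perfectMatchings, matchingsOn]

theorem matchingsOn_empty : matchingsOn (∅ : Finset α) = {1} := by
  ext σ
  simp only [mem_matchingsOn, Finset.notMem_empty, false_iff, not_not, Finset.mem_singleton]
  constructor
  · rintro ⟨-, h⟩
    exact Equiv.ext h
  · rintro rfl
    simp

theorem swap_mul_mem_matchingsOn_erase {s : Finset α} {σ : Equiv.Perm α} {x y : α}
    (hxy : x ≠ y) (hσ : σ ∈ matchingsOn s) (h : σ x = y) :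
    Equiv.swap x y * σ ∈ matchingsOn ((s.erase x).erase y) := by
  rw [mem_matchingsOn] at hσ ⊢
  obtain ⟨h1, h2⟩ := hσ
  have hy : σ y = x := by rw [← h, h1]
  have hval : ∀ v, (Equiv.swap x y * σ) v = if v = x ∨ v = y then v else σ v := by
    intro v
    simp only [Equiv.Perm.mul_apply, Equiv.swap_apply_def]
    grind
  simp only [hval]
  grind

theorem swap_mul_mem_matchingsOn {s : Finset α} {τ : Equiv.Perm α} {x y : α}
    (hxy : x ≠ y) (hx : x ∈ s) (hy : y ∈ s) (hτ : τ ∈ matchingsOn ((s.erase x).erase y)) :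
    Equiv.swap x y * τ ∈ matchingsOn s := by
  rw [mem_matchingsOn] at hτ ⊢
  obtain ⟨h1, h2⟩ := hτ
  have hval : ∀ v, (Equiv.swap x y * τ) v = if v = x then y else if v = y then x else τ v := by
    intro v
    simp only [Equiv.Perm.mul_apply, Equiv.swap_apply_def]
    grind
  simp only [hval]
  grind

theorem sum_matchingsOn {β : Type*} [AddCommMonoid β] {s : Finset α} {x : α} (hx : x ∈ s)
    (F : Equiv.Perm α → β) :
    ∑ σ ∈ matchingsOn s, F σ =
      ∑ y ∈ s.erase x, ∑ τ ∈ matchingsOn ((s.erase x).erase y), F (Equiv.swap x y * τ) := by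
  have hmaps : ∀ σ ∈ matchingsOn s, σ x ∈ s.erase x := by
    intro σ hσ
    rw [mem_matchingsOn] at hσ
    grind
  rw [← Finset.sum_fiberwise_of_maps_to hmaps]
  refine Finset.sum_congr rfl fun y hy => ?_
  have hxy : x ≠ y := (Finset.ne_of_mem_erase hy).symm
  refine Finset.sum_nbij' (fun σ => Equiv.swap x y * σ) (fun τ => Equiv.swap x y * τ)
    ?_ ?_ ?_ ?_ ?_
  · intro σ hσ
    rw [Finset.mem_filter] at hσ
    exact swap_mul_mem_matchingsOn_erase hxy hσ.1 hσ.2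
  · intro τ hτ
    refine Finset.mem_filter.2
      ⟨swap_mul_mem_matchingsOn hxy hx (Finset.mem_of_mem_erase hy) hτ, ?_⟩
    have hτx : τ x = x := by
      rw [mem_matchingsOn] at hτ
      grind
    simp [hτx]
  · simp
  · simp
  · simp

theorem card_matchingsOn (s : Finset α) (hs : Even s.card) :
    (matchingsOn s).card = (s.card - 1).doubleFactorial := by
  induction hn : s.card using Nat.strong_induction_on generalizing s with
  | _ n ih =>
    subst hn
    rcases s.eq_empty_or_nonempty with rfl | ⟨x, hx⟩
    · simp [matchingsOn_empty]
    have hpos : 2 ≤ s.card := by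
      have := Finset.card_pos.2 ⟨x, hx⟩
      obtain ⟨k, hk⟩ := hs
      omega
    obtain ⟨k, hk⟩ := Nat.exists_eq_add_of_le' hpos
    have hsum : ∀ y ∈ s.erase x,
        ∑ τ ∈ matchingsOn ((s.erase x).erase y), 1 = (k - 1).doubleFactorial := by
      intro y hy
      have hcard : ((s.erase x).erase y).card = k := by
        rw [Finset.card_erase_of_mem hy, Finset.card_erase_of_mem hx]
        omega
      rw [← Finset.card_eq_sum_ones, ih k (by omega) _ _ hcard]
      rw [hcard]
      rw [hk] at hs
      grind
    rw [Finset.card_eq_sum_ones, sum_matchingsOn hx, Finset.sum_congr rfl hsum,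
      Finset.sum_const, Finset.card_erase_of_mem hx, hk]
    rcases k with _ | k
    · simp
    · simp [Nat.doubleFactorial]

theorem crossCount_swap_mul {s L R : Finset α} {τ : Equiv.Perm α} {x y : α}
    (hLR : Disjoint L R) (hx : x ∈ L)
    (hτ : τ ∈ matchingsOn ((s.erase x).erase y)) :
    crossCount (Equiv.swap x y * τ) L R =
      (if y ∈ R then 1 else 0) + crossCount τ ((L.erase x).erase y) (R.erase y) := by
  rw [mem_matchingsOn] at hτ
  obtain ⟨h1, h2⟩ := hτ
  have hxR : x ∉ R := Finset.disjoint_left.1 hLR hx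
  have hval : ∀ v, (Equiv.swap x y * τ) v = if v = x then y else if v = y then x else τ v := by
    intro v
    simp only [Equiv.Perm.mul_apply, Equiv.swap_apply_def]
    grind
  have hset : (L.filter fun v => (Equiv.swap x y * τ) v ∈ R).erase x =
      ((L.erase x).erase y).filter fun v => τ v ∈ R.erase y := by
    ext v
    simp only [hval, Finset.mem_erase, Finset.mem_filter]
    grind
  have hmem : x ∈ (L.filter fun v => (Equiv.swap x y * τ) v ∈ R) ↔ y ∈ R := by
    simp [hval, hx]
  unfold crossCount
  rw [← hset]
  split_ifs with hy
  · have := Finset.card_erase_add_one (hmem.2 hy)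
    omega
  · rw [Finset.erase_eq_of_notMem (mt hmem.1 hy), zero_add]

end Matchings

open Polynomial in
theorem kraw_eq_coeff (r m i : ℕ) :
    kraw (r + m) i r = ((1 - X : ℤ[X]) ^ r * (1 + X) ^ m).coeff i := by
  have h : ∀ q, ((1 - X : ℤ[X]) ^ r).coeff q = (-1) ^ q * (r.choose q : ℤ) := by
    intro q
    have : (1 - X : ℤ[X]) ^ r = ((1 + X : ℤ[X]) ^ r).comp (C (-1) * X) := by
      simp [sub_eq_add_neg]
    rw [this, comp_C_mul_X_coeff, coeff_one_add_X_pow, mul_comm]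
  rw [coeff_mul, Finset.Nat.sum_antidiagonal_eq_sum_range_succ_mk, kraw]
  refine Finset.sum_congr rfl fun q _ => ?_
  rw [h, coeff_one_add_X_pow, Nat.add_sub_cancel_left]

open Polynomial in
theorem succ_mul_kraw_succ (r m i : ℕ) :
    ((i : ℤ) + 1) * kraw (r + m) (i + 1) r =
      m * kraw (r + (m - 1)) i r - r * kraw (r - 1 + m) i (r - 1) := by
  simp only [kraw_eq_coeff]
  have h := coeff_derivative ((1 - X : ℤ[X]) ^ r * (1 + X) ^ m) i
  rw [mul_comm, ← h]
  have hd : derivative ((1 - X : ℤ[X]) ^ r * (1 + X) ^ m) =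
      C (m : ℤ) * ((1 - X) ^ r * (1 + X) ^ (m - 1)) -
        C (r : ℤ) * ((1 - X) ^ (r - 1) * (1 + X) ^ m) := by
    simp [derivative_mul, derivative_pow]
    ring
  rw [hd, coeff_sub, coeff_C_mul, coeff_C_mul]

/-- The number `l! / (l - i)!!` of ways to choose a matching on all but `i` points of an `l`-set
together with an ordering of the remaining `i` points; it vanishes for `i > l` and for
`i ≢ l (mod 2)`. -/
def partialMatchingCoeff (l i : ℕ) : ℝ :=
  if i ≤ l ∧ i % 2 = l % 2 then (l.factorial : ℝ) / ((l - i).doubleFactorial : ℝ) else 0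

theorem partialMatchingCoeff_of_lt {l i : ℕ} (h : l < i) : partialMatchingCoeff l i = 0 :=
  if_neg (by omega)

theorem partialMatchingCoeff_succ_zero (k : ℕ) :
    partialMatchingCoeff (k + 1) 0 = k * partialMatchingCoeff (k - 1) 0 := by
  rcases k with _ | k
  · simp [partialMatchingCoeff]
  unfold partialMatchingCoeff
  by_cases h : k % 2 = 0
  · rw [if_pos (by omega), if_pos (by omega)]
    have : ((k.doubleFactorial : ℕ) : ℝ) ≠ 0 := by
      exact_mod_cast (Nat.doubleFactorial_pos k).ne'
    simp only [Nat.sub_zero, Nat.add_sub_cancel, Nat.factorial_succ, Nat.doubleFactorial]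
    push_cast
    field_simp
    ring
  · rw [if_neg (by omega), if_neg (by omega), mul_zero]

theorem partialMatchingCoeff_succ_succ (k i : ℕ) :
    partialMatchingCoeff (k + 1) (i + 1) =
      k * partialMatchingCoeff (k - 1) (i + 1) + (i + 1) * partialMatchingCoeff k i := by
  unfold partialMatchingCoeff
  by_cases h : i ≤ k ∧ i % 2 = k % 2
  · obtain ⟨j, rfl⟩ := Nat.exists_eq_add_of_le h.1
    rw [if_pos (by omega), if_pos h]
    rcases j with _ | _ | j
    · rw [if_neg (by omega)]
      simp [Nat.factorial_succ]
    · omega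
    · have : ((j.doubleFactorial : ℕ) : ℝ) ≠ 0 := by
        exact_mod_cast (Nat.doubleFactorial_pos j).ne'
      rw [if_pos (by omega), show i + (j + 1 + 1) + 1 - (i + 1) = j + 2 by omega,
        show i + (j + 1 + 1) - 1 - (i + 1) = j by omega,
        show i + (j + 1 + 1) - i = j + 2 by omega,
        show i + (j + 1 + 1) - 1 = i + j + 1 by omega,
        show i + (j + 1 + 1) = i + j + 1 + 1 by omega]
      simp only [Nat.factorial_succ, Nat.doubleFactorial]
      push_cast
      field_simp
      ring
  · rw [if_neg (by omega), if_neg h, mul_zero, add_zero]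
    rcases k with _ | k
    · simp
    · rw [if_neg (by omega), mul_zero]

/-- The sum of `(-1) ^ e_M(L, R)` over all perfect matchings of a set, where `l = |L|`, `r = |R|`,
and `m` is the number of points in neither `L` nor `R`. -/
def signedMatchingSum (l r m : ℕ) : ℝ :=
  ∑ i ∈ Finset.range (l + 1),
    partialMatchingCoeff l i * (kraw (r + m) i r * ((r + m - i - 1).doubleFactorial : ℝ))

theorem signedMatchingSum_eq_sum_range {l N : ℕ} (r m : ℕ) (h : l + 1 ≤ N) :
    signedMatchingSum l r m = ∑ i ∈ Finset.range N,
      partialMatchingCoeff l i * (kraw (r + m) i r * ((r + m - i - 1).doubleFactorial : ℝ)) := by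
  refine Finset.sum_subset (Finset.range_subset_range.2 h) fun i _ hi => ?_
  rw [Finset.mem_range] at hi
  rw [partialMatchingCoeff_of_lt (by omega), zero_mul]

theorem signedMatchingSum_zero (r m : ℕ) :
    signedMatchingSum 0 r m = ((r + m - 1).doubleFactorial : ℝ) := by
  simp [signedMatchingSum, partialMatchingCoeff, kraw]

theorem signedMatchingSum_succ (k r m : ℕ) :
    signedMatchingSum (k + 1) r m =
      k * signedMatchingSum (k - 1) r m - r * signedMatchingSum k (r - 1) m +
        m * signedMatchingSum k r (m - 1) := by
  have hr : (r : ℝ) * signedMatchingSum k (r - 1) m = ∑ i ∈ Finset.range (k + 1),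
      partialMatchingCoeff k i * (r * kraw (r - 1 + m) i (r - 1) *
        ((r + m - (i + 1) - 1).doubleFactorial : ℝ)) := by
    rw [signedMatchingSum, Finset.mul_sum]
    refine Finset.sum_congr rfl fun i _ => ?_
    rcases r with _ | r
    · simp
    · rw [show r + 1 - 1 + m - i - 1 = r + 1 + m - (i + 1) - 1 by omega]
      ring
  have hm : (m : ℝ) * signedMatchingSum k r (m - 1) = ∑ i ∈ Finset.range (k + 1),
      partialMatchingCoeff k i * (m * kraw (r + (m - 1)) i r *
        ((r + m - (i + 1) - 1).doubleFactorial : ℝ)) := by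
    rw [signedMatchingSum, Finset.mul_sum]
    refine Finset.sum_congr rfl fun i _ => ?_
    rcases m with _ | m
    · simp
    · rw [show r + (m + 1 - 1) - i - 1 = r + (m + 1) - (i + 1) - 1 by omega]
      ring
  rw [hr, hm, signedMatchingSum_eq_sum_range (l := k - 1) (N := k + 2) r m (by omega),
    signedMatchingSum, Finset.sum_range_succ', Finset.sum_range_succ' _ (k + 1),
    partialMatchingCoeff_succ_zero, mul_add, Finset.mul_sum, sub_add_eq_add_sub, add_right_comm,
    add_sub_right_comm, ← Finset.sum_add_distrib, ← Finset.sum_sub_distrib]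
  congr 1
  · refine Finset.sum_congr rfl fun i _ => ?_
    have h : ((i : ℝ) + 1) * kraw (r + m) (i + 1) r =
        m * kraw (r + (m - 1)) i r - r * kraw (r - 1 + m) i (r - 1) := by
      exact_mod_cast succ_mul_kraw_succ r m i
    rw [partialMatchingCoeff_succ_succ]
    linear_combination (partialMatchingCoeff k i *
      ((r + m - (i + 1) - 1).doubleFactorial : ℝ)) * h
  · ring

theorem sum_matchingsOn_neg_one_pow_crossCount {α : Type*} [Fintype α] [DecidableEq α]
    {s L R : Finset α} (hs : Even s.card) (hLs : L ⊆ s) (hRs : R ⊆ s) (hLR : Disjoint L R) :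
    ∑ σ ∈ matchingsOn s, (-1 : ℝ) ^ crossCount σ L R =
      signedMatchingSum L.card R.card ((s \ L) \ R).card := by
  induction hn : s.card using Nat.strong_induction_on generalizing s L R with
  | _ n ih =>
    subst hn
    have hRs' : R ⊆ s \ L := fun v hv =>
      Finset.mem_sdiff.2 ⟨hRs hv, Finset.disjoint_right.1 hLR hv⟩
    have hcL := Finset.card_sdiff_add_card_eq_card hLs
    have hcR := Finset.card_sdiff_add_card_eq_card hRs'
    rcases L.eq_empty_or_nonempty with rfl | ⟨x, hx⟩
    · rw [Finset.card_empty, signedMatchingSum_zero, add_comm, hcR]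
      simp [crossCount, card_matchingsOn s hs]
    obtain ⟨k, hk⟩ := Nat.exists_eq_add_one.2 (Finset.card_pos.2 ⟨x, hx⟩)
    have hLx : (L.erase x).card = k := by rw [Finset.card_erase_of_mem hx, hk]; simp
    have hstep : ∀ y ∈ s.erase x,
        ∑ τ ∈ matchingsOn ((s.erase x).erase y), (-1 : ℝ) ^ crossCount (Equiv.swap x y * τ) L R =
          (-1 : ℝ) ^ (if y ∈ R then 1 else 0) *
            signedMatchingSum ((L.erase x).erase y).card (R.erase y).card
              (((s \ L) \ R).erase y).card := by
      intro y hy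
      have hcs : ((s.erase x).erase y).card + 2 = s.card := by
        have h1 := Finset.card_erase_add_one hy
        have h2 := Finset.card_erase_add_one (hLs hx)
        omega
      have hrest : (((s.erase x).erase y) \ ((L.erase x).erase y)) \ (R.erase y) =
          ((s \ L) \ R).erase y := by
        ext v
        simp only [Finset.mem_sdiff, Finset.mem_erase]
        grind
      rw [← hrest, ← ih _ (by omega) (by rw [← hcs] at hs; grind)
        (Finset.erase_subset_erase _ (Finset.erase_subset_erase _ hLs))
        (fun v hv => by
          have := Finset.disjoint_left.1 hLR hx
          have := @hRs v
          grind)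
        (hLR.mono ((Finset.erase_subset _ _).trans (Finset.erase_subset _ _))
          (Finset.erase_subset _ _)) rfl, Finset.mul_sum]
      refine Finset.sum_congr rfl fun τ hτ => ?_
      rw [crossCount_swap_mul hLR hx hτ, pow_add]
    have hsplit : s.erase x = (L.erase x ∪ R) ∪ ((s \ L) \ R) := by
      ext v
      have := @hLs v
      have := @hRs v
      have := Finset.disjoint_left.1 hLR hx
      simp only [Finset.mem_union, Finset.mem_sdiff, Finset.mem_erase]
      grind
    have hd1 : Disjoint (L.erase x) R := hLR.mono_left (Finset.erase_subset _ _)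
    have hd2 : Disjoint (L.erase x ∪ R) ((s \ L) \ R) := by
      rw [Finset.disjoint_left]
      grind
    rw [sum_matchingsOn (hLs hx), Finset.sum_congr rfl hstep, hsplit, Finset.sum_union hd2,
      Finset.sum_union hd1, hk, signedMatchingSum_succ, sub_eq_add_neg]
    congr 1
    · congr 1
      · rw [← hLx, ← nsmul_eq_mul, ← Finset.sum_const]
        refine Finset.sum_congr rfl fun y hy => ?_
        have hyR := Finset.disjoint_left.1 hd1 hy
        have hyT : y ∉ (s \ L) \ R := by grind
        rw [if_neg hyR, Finset.erase_eq_of_notMem hyR, Finset.erase_eq_of_notMem hyT,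
          Finset.card_erase_of_mem hy, pow_zero, one_mul]
      · rw [← mul_neg, ← nsmul_eq_mul, ← Finset.sum_const]
        refine Finset.sum_congr rfl fun y hy => ?_
        have hyL := Finset.disjoint_right.1 hd1 hy
        have hyT : y ∉ (s \ L) \ R := by grind
        rw [if_pos hy, Finset.erase_eq_of_notMem hyL, Finset.erase_eq_of_notMem hyT,
          Finset.card_erase_of_mem hy, hLx, pow_one, neg_one_mul]
    · rw [← nsmul_eq_mul, ← Finset.sum_const]
      refine Finset.sum_congr rfl fun y hy => ?_
      have hyR : y ∉ R := by grind
      have hyL : y ∉ L.erase x := by grind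
      rw [if_neg hyR, Finset.erase_eq_of_notMem hyR, Finset.erase_eq_of_notMem hyL,
        Finset.card_erase_of_mem hy, hLx, pow_zero, one_mul]

/-- the average crossing parity of a uniformly random perfect matching of
`{1,…,n}` between disjoint sets `L`, `R` expressed with Krawtchouk polynomials. -/
theorem stmt_1 (n : ℕ) (hn : 0 < n) (hne : Even n) (L R : Finset (Fin n))
    (hLR : Disjoint L R) (hL : L.card ≤ n - L.card - R.card)
    (hR : R.card ≤ n - L.card - R.card) :
    matchingAvg (Fin n) (fun σ => (-1 : ℝ) ^ crossCount σ L R) =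
      ∑ i ∈ (Finset.range (L.card + 1)).filter (fun i => i % 2 = L.card % 2),
        (kraw (n - L.card) i R.card : ℝ) * (L.card.factorial : ℝ) *
            ((n - L.card - i - 1).doubleFactorial : ℝ) /
          (((L.card - i).doubleFactorial : ℝ) * ((n - 1).doubleFactorial : ℝ)) := by
  have hcard : (Finset.univ : Finset (Fin n)).card = n := Finset.card_fin n
  have hrest : R.card + ((Finset.univ \ L) \ R).card = n - L.card := by
    have hRs : R ⊆ Finset.univ \ L := fun v hv =>
      Finset.mem_sdiff.2 ⟨Finset.mem_univ v, Finset.disjoint_right.1 hLR hv⟩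
    have h1 := Finset.card_sdiff_add_card_eq_card (Finset.subset_univ L)
    have h2 := Finset.card_sdiff_add_card_eq_card hRs
    omega
  have heven : Even (Finset.univ : Finset (Fin n)).card := by rwa [hcard]
  rw [matchingAvg, perfectMatchings_eq_matchingsOn_univ, card_matchingsOn _ heven, hcard,
    sum_matchingsOn_neg_one_pow_crossCount heven (Finset.subset_univ L) (Finset.subset_univ R) hLR,
    signedMatchingSum, hrest, Finset.sum_div, Finset.sum_filter]
  refine Finset.sum_congr rfl fun i hi => ?_
  rw [Finset.mem_range, Nat.lt_succ_iff] at hi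
  unfold partialMatchingCoeff
  by_cases h : i % 2 = L.card % 2
  · rw [if_pos ⟨hi, h⟩, if_pos h]
    ring
  · rw [if_neg (fun h' => h h'.2), if_neg h]
    simp
end
end

section
/- Let G be a simple graph on vertex set {1,…,n}. Then the uniform average over measurement angles θ ∈ [0,2π)^n of the normalized second moment of the X-Y plane output distribution of the graph state of G equals a purely combinatorial sum: (2π)^{-n} ∫_{[0,2π]^n} m₂(G,θ) dθ = 2^{-n} Σ_{L,R ⊆ {1,…,n}, L ∩ R = ∅} (−1)^{e_G(L,R)}, where e_G(L,R) is the number of edges of G with one endpoint in L and the other in R. -/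
open scoped BigOperators
open MeasureTheory

noncomputable section

/-- The amplitude `2^{-n} Σ_z (−1)^{Σ_{i<j} m_{ij} z_i z_j + Σ_i x_i z_i}
Π_j exp(−i θ_j (−1)^{z_j})` of measuring the graph state of the multigraph with edge
multiplicities `m` in the X-Y plane product basis with angles `θ`, at outcome `x`. -/
def gsAmp (n : ℕ) (m : Fin n → Fin n → ℕ) (θ : Fin n → ℝ) (x : Fin n → Bool) : ℂ :=
  (1 / 2 ^ n : ℂ) * ∑ z : Fin n → Bool,
    (-1 : ℂ) ^ ((∑ i : Fin n, ∑ j : Fin n, if i < j ∧ z i ∧ z j then m i j else 0) +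
        ∑ i : Fin n, (if x i ∧ z i then 1 else 0)) *
      ∏ j : Fin n, Complex.exp (-Complex.I * (θ j : ℂ) * (-1 : ℂ) ^ (if z j then 1 else 0))

/-- The output probability `p_{G,θ}(x)`. -/
def gsProb (n : ℕ) (m : Fin n → Fin n → ℕ) (θ : Fin n → ℝ) (x : Fin n → Bool) : ℝ :=
  Complex.normSq (gsAmp n m θ x)

/-- The normalized second moment `m₂(G,θ) = 2^n Σ_x p_{G,θ}(x)²`. -/
def secondMoment (n : ℕ) (m : Fin n → Fin n → ℕ) (θ : Fin n → ℝ) : ℝ :=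
  2 ^ n * ∑ x : Fin n → Bool, (gsProb n m θ x) ^ 2

/-- The uniform average `(2π)^{-n} ∫_{[0,2π]^n} m₂(G,θ) dθ` over measurement angles. -/
def avgSecondMoment (n : ℕ) (m : Fin n → Fin n → ℕ) : ℝ :=
  ((2 * Real.pi) ^ n)⁻¹ *
    ∫ θ in Set.univ.pi (fun _ : Fin n => Set.Icc (0 : ℝ) (2 * Real.pi)), secondMoment n m θ

/-- The sign `(−1)^{Σ_{i<j} m_{ij} z_i z_j + Σ_i x_i z_i}` of the term indexed by `z` in the
amplitude `gsAmp`. -/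
def gsSign {n : ℕ} (m : Fin n → Fin n → ℕ) (x z : Fin n → Bool) : ℂ :=
  (-1 : ℂ) ^ ((∑ i : Fin n, ∑ j : Fin n, if i < j ∧ z i ∧ z j then m i j else 0) +
    ∑ i : Fin n, (if x i ∧ z i then 1 else 0))

/-- The eigenvalue `(−1)^b` as an integer. -/
def spin (b : Bool) : ℤ := (-1) ^ (if b then 1 else 0)

/-- The frequency in a single angle of a term of the fourth-order expansion of the amplitude. -/
def spinDefect (z w v u : Bool) : ℤ := -spin z + spin w + spin v - spin u

lemma conj_gsSign {n : ℕ} (m : Fin n → Fin n → ℕ) (x z : Fin n → Bool) :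
    (starRingEnd ℂ) (gsSign m x z) = gsSign m x z := by
  simp [gsSign]

lemma gsAmp_eq {n : ℕ} (m : Fin n → Fin n → ℕ) (θ : Fin n → ℝ) (x : Fin n → Bool) :
    gsAmp n m θ x = (1 / 2 ^ n : ℂ) * ∑ z : Fin n → Bool,
      gsSign m x z * ∏ j, Complex.exp (Complex.I * (-spin (z j) : ℤ) * θ j) := by
  unfold gsAmp gsSign spin
  congr 1
  refine Finset.sum_congr rfl fun z _ => ?_
  congr 1
  refine Finset.prod_congr rfl fun j _ => ?_
  congr 1
  push_cast
  ring

lemma conj_gsAmp {n : ℕ} (m : Fin n → Fin n → ℕ) (θ : Fin n → ℝ) (x : Fin n → Bool) :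
    (starRingEnd ℂ) (gsAmp n m θ x) = (1 / 2 ^ n : ℂ) * ∑ z : Fin n → Bool,
      gsSign m x z * ∏ j, Complex.exp (Complex.I * (spin (z j) : ℤ) * θ j) := by
  rw [gsAmp_eq]
  simp only [map_mul, map_sum, map_prod, conj_gsSign, ← Complex.exp_conj, Complex.conj_I,
    Complex.conj_ofReal]
  simp [Complex.conj_ofNat]

lemma gsProb_sq {n : ℕ} (m : Fin n → Fin n → ℕ) (θ : Fin n → ℝ) (x : Fin n → Bool) :
    ((gsProb n m θ x ^ 2 : ℝ) : ℂ) = (1 / 2 ^ n : ℂ) ^ 4 *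
      ∑ z : Fin n → Bool, ∑ w : Fin n → Bool, ∑ v : Fin n → Bool, ∑ u : Fin n → Bool,
        gsSign m x z * gsSign m x w * gsSign m x v * gsSign m x u *
          ∏ j, Complex.exp (Complex.I * spinDefect (z j) (w j) (v j) (u j) * θ j) := by
  have h : ((gsProb n m θ x ^ 2 : ℝ) : ℂ) =
      gsAmp n m θ x * ((starRingEnd ℂ) (gsAmp n m θ x) *
        ((starRingEnd ℂ) (gsAmp n m θ x) * gsAmp n m θ x)) := by
    rw [gsProb, Complex.ofReal_pow, Complex.normSq_eq_conj_mul_self]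
    ring
  rw [h, conj_gsAmp, gsAmp_eq]
  have h4 : ∀ c a b : ℂ, c * a * (c * b * (c * b * (c * a))) = c ^ 4 * (a * (b * (b * a))) := by
    intros; ring
  rw [h4]
  congr 1
  rw [Finset.sum_mul]
  refine Finset.sum_congr rfl fun z _ => ?_
  rw [Finset.sum_mul, Finset.mul_sum]
  refine Finset.sum_congr rfl fun w _ => ?_
  rw [Finset.sum_mul, Finset.mul_sum, Finset.mul_sum]
  refine Finset.sum_congr rfl fun v _ => ?_
  rw [Finset.mul_sum, Finset.mul_sum, Finset.mul_sum]
  refine Finset.sum_congr rfl fun u _ => ?_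
  have hexp : ∏ j, Complex.exp (Complex.I * spinDefect (z j) (w j) (v j) (u j) * θ j) =
      (∏ j, Complex.exp (Complex.I * (-spin (z j) : ℤ) * θ j)) *
        (∏ j, Complex.exp (Complex.I * (spin (w j) : ℤ) * θ j)) *
        (∏ j, Complex.exp (Complex.I * (spin (v j) : ℤ) * θ j)) *
        ∏ j, Complex.exp (Complex.I * (-spin (u j) : ℤ) * θ j) := by
    simp only [← Finset.prod_mul_distrib, ← Complex.exp_add]
    refine Finset.prod_congr rfl fun j _ => ?_
    congr 1
    unfold spinDefect
    push_cast
    ring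
  rw [hexp]
  ring

lemma setIntegral_exp_int (k : ℤ) :
    ∫ t in Set.Icc (0 : ℝ) (2 * Real.pi), Complex.exp (Complex.I * k * t) =
      if k = 0 then (2 * Real.pi : ℂ) else 0 := by
  rw [integral_Icc_eq_integral_Ioc, ← intervalIntegral.integral_of_le (by positivity)]
  split_ifs with hk
  · simp [hk]
  · rw [integral_exp_mul_complex (by simp [hk])]
    have : Complex.exp (Complex.I * k * (2 * Real.pi : ℝ)) = 1 := by
      rw [← Complex.exp_int_mul_two_pi_mul_I k]
      congr 1
      push_cast
      ring
    rw [this]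
    simp

lemma setIntegral_prod_exp_int {n : ℕ} (k : Fin n → ℤ) :
    ∫ θ in Set.univ.pi (fun _ : Fin n => Set.Icc (0 : ℝ) (2 * Real.pi)),
      ∏ j, Complex.exp (Complex.I * k j * θ j) =
      if ∀ j, k j = 0 then (2 * Real.pi : ℂ) ^ n else 0 := by
  rw [volume_pi, Measure.restrict_pi_pi,
    integral_fintype_prod_eq_prod (fun j (t : ℝ) => Complex.exp (Complex.I * k j * t))]
  simp only [setIntegral_exp_int]
  rw [Finset.prod_ite_zero]
  simp

/-- Flip the bits of `z` at the positions in `L`. -/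
def flipOn {n : ℕ} (z : Fin n → Bool) (L : Finset (Fin n)) : Fin n → Bool :=
  fun j => z j ^^ decide (j ∈ L)

/-- Bit strings correspond to the set of positions at which they differ from `z`. -/
def flipEquiv {n : ℕ} (z : Fin n → Bool) : Finset (Fin n) ≃ (Fin n → Bool) where
  toFun := flipOn z
  invFun w := Finset.univ.filter fun j => (z j ^^ w j) = true
  left_inv L := by
    ext j
    rw [Finset.mem_filter]
    simp [flipOn]
  right_inv w := by
    funext j
    cases h : z j <;> cases hw : w j <;> simp [flipOn, h, hw]

lemma sum_flipOn {n : ℕ} (z : Fin n → Bool) (f : (Fin n → Bool) → ℂ) :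
    ∑ w, f w = ∑ L : Finset (Fin n), f (flipOn z L) :=
  (Equiv.sum_comp (flipEquiv z) f).symm

lemma spinDefect_eq_zero_iff (z a r u : Bool) :
    spinDefect z (z ^^ a) (z ^^ r) u = 0 ↔ (a && r) = false ∧ u = (z ^^ a ^^ r) := by
  revert z a r u
  decide

lemma forall_spinDefect_flipOn {n : ℕ} (z u : Fin n → Bool) (L R : Finset (Fin n)) :
    (∀ j, spinDefect (z j) (flipOn z L j) (flipOn z R j) (u j) = 0) ↔
      Disjoint L R ∧ u = flipOn (flipOn z L) R := by
  simp only [flipOn, spinDefect_eq_zero_iff, forall_and, funext_iff, Finset.disjoint_left]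
  simp

lemma pair_sign_mul (p q a b r s : Bool) (k : ℕ) :
    (-1 : ℂ) ^ (if p ∧ q then k else 0) *
      (-1 : ℂ) ^ (if (p ^^ a) ∧ (q ^^ b) then k else 0) *
      (-1 : ℂ) ^ (if (p ^^ r) ∧ (q ^^ s) then k else 0) *
      (-1 : ℂ) ^ (if (p ^^ a ^^ r) ∧ (q ^^ b ^^ s) then k else 0) =
    (-1 : ℂ) ^ (if a ∧ s then k else 0) * (-1 : ℂ) ^ (if b ∧ r then k else 0) := by
  rcases neg_one_pow_eq_or ℂ k with h | h <;>
    cases p <;> cases q <;> cases a <;> cases b <;> cases r <;> cases s <;> simp [h]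

lemma single_sign_mul (p x a r : Bool) :
    (-1 : ℂ) ^ (if x ∧ p then 1 else 0) * (-1 : ℂ) ^ (if x ∧ (p ^^ a) then 1 else 0) *
      (-1 : ℂ) ^ (if x ∧ (p ^^ r) then 1 else 0) *
      (-1 : ℂ) ^ (if x ∧ (p ^^ a ^^ r) then 1 else 0) = 1 := by
  cases x <;> cases p <;> cases a <;> cases r <;> simp

lemma gsSign_eq_prod {n : ℕ} (m : Fin n → Fin n → ℕ) (x z : Fin n → Bool) :
    gsSign m x z =
      (∏ i, ∏ j, if i < j then (-1 : ℂ) ^ (if z i ∧ z j then m i j else 0) else 1) *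
        ∏ i, (-1 : ℂ) ^ (if x i ∧ z i then 1 else 0) := by
  rw [gsSign, pow_add, ← Finset.prod_pow_eq_pow_sum, ← Finset.prod_pow_eq_pow_sum]
  congr 1
  refine Finset.prod_congr rfl fun i _ => ?_
  rw [← Finset.prod_pow_eq_pow_sum]
  refine Finset.prod_congr rfl fun j _ => ?_
  by_cases h : i < j <;> simp [h]

lemma prod_lt_mul_swap {n : ℕ} (f : Fin n → Fin n → ℂ) (hf : ∀ i, f i i = 1) :
    (∏ i, ∏ j, if i < j then f i j * f j i else 1) = ∏ i, ∏ j, f i j := by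
  have h : ∀ i j : Fin n, (if i < j then f i j * f j i else 1) =
      (if i < j then f i j else 1) * (if i < j then f j i else 1) := by
    intro i j
    split_ifs <;> simp
  simp only [h, Finset.prod_mul_distrib]
  rw [Finset.prod_comm (f := fun i j => if i < j then f j i else 1)]
  simp only [← Finset.prod_mul_distrib]
  refine Finset.prod_congr rfl fun i _ => Finset.prod_congr rfl fun j _ => ?_
  rcases lt_trichotomy i j with h | h | h
  · simp [h, h.not_gt]
  · simp [h, hf]
  · simp [h, h.not_gt]

lemma gsSign_mul_flipOn {n : ℕ} {m : Fin n → Fin n → ℕ} (hm : ∀ i j, m i j = m j i)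
    (x z : Fin n → Bool) {L R : Finset (Fin n)} (hLR : Disjoint L R) :
    gsSign m x z * gsSign m x (flipOn z L) * gsSign m x (flipOn z R) *
      gsSign m x (flipOn (flipOn z L) R) = (-1 : ℂ) ^ (∑ i ∈ L, ∑ j ∈ R, m i j) := by
  have h4 : ∀ a b c d p q r s : ℂ, (a * p) * (b * q) * (c * r) * (d * s) =
      (a * b * c * d) * (p * q * r * s) := by
    intros; ring
  simp only [gsSign_eq_prod]
  rw [h4]
  have hsingle : (∏ i, (-1 : ℂ) ^ (if x i ∧ z i then 1 else 0)) *
      (∏ i, (-1 : ℂ) ^ (if x i ∧ flipOn z L i then 1 else 0)) *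
      (∏ i, (-1 : ℂ) ^ (if x i ∧ flipOn z R i then 1 else 0)) *
      (∏ i, (-1 : ℂ) ^ (if x i ∧ flipOn (flipOn z L) R i then 1 else 0)) = 1 := by
    simp only [← Finset.prod_mul_distrib]
    exact Finset.prod_eq_one fun i _ => single_sign_mul _ _ _ _
  rw [hsingle, mul_one]
  simp only [← Finset.prod_mul_distrib, flipOn]
  have hR : (-1 : ℂ) ^ (∑ i ∈ L, ∑ j ∈ R, m i j) =
      ∏ i, ∏ j, (-1 : ℂ) ^ (if decide (i ∈ L) ∧ decide (j ∈ R) then m i j else 0) := by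
    simp only [Finset.prod_pow_eq_pow_sum]
    congr 1
    simp [ite_and, Finset.sum_ite_mem, Finset.sum_ite_irrel]
  rw [hR]
  refine Eq.trans ?_ (prod_lt_mul_swap _ ?_)
  · refine Finset.prod_congr rfl fun i _ => Finset.prod_congr rfl fun j _ => ?_
    by_cases h : i < j
    · simp only [h, if_true, hm j i]
      exact pair_sign_mul (z i) (z j) _ _ _ _ (m i j)
    · simp [h]
  · intro i
    have : i ∈ L → i ∉ R := fun h => Finset.disjoint_left.mp hLR h
    simp +contextual [this]

lemma sum_balanced_gsSign {n : ℕ} {m : Fin n → Fin n → ℕ} (hm : ∀ i j, m i j = m j i)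
    (x : Fin n → Bool) (c : ℂ) :
    ∑ z : Fin n → Bool, ∑ w : Fin n → Bool, ∑ v : Fin n → Bool, ∑ u : Fin n → Bool,
      gsSign m x z * gsSign m x w * gsSign m x v * gsSign m x u *
        (if ∀ j, spinDefect (z j) (w j) (v j) (u j) = 0 then c else 0) =
      2 ^ n * c * ∑ L : Finset (Fin n), ∑ R : Finset (Fin n),
        if Disjoint L R then (-1 : ℂ) ^ (∑ i ∈ L, ∑ j ∈ R, m i j) else 0 := by
  have key : ∀ z : Fin n → Bool,
      ∑ w : Fin n → Bool, ∑ v : Fin n → Bool, ∑ u : Fin n → Bool,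
      gsSign m x z * gsSign m x w * gsSign m x v * gsSign m x u *
        (if ∀ j, spinDefect (z j) (w j) (v j) (u j) = 0 then c else 0) =
      c * ∑ L : Finset (Fin n), ∑ R : Finset (Fin n),
        if Disjoint L R then (-1 : ℂ) ^ (∑ i ∈ L, ∑ j ∈ R, m i j) else 0 := by
    intro z
    rw [sum_flipOn z, Finset.mul_sum]
    refine Finset.sum_congr rfl fun L _ => ?_
    rw [sum_flipOn z, Finset.mul_sum]
    refine Finset.sum_congr rfl fun R _ => ?_
    simp only [forall_spinDefect_flipOn]
    by_cases hLR : Disjoint L R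
    · simp [hLR, gsSign_mul_flipOn hm, mul_comm c]
    · simp [hLR]
  rw [Finset.sum_congr rfl fun z _ => key z]
  simp [mul_assoc]

lemma setIntegral_gsProb_sq {n : ℕ} {m : Fin n → Fin n → ℕ} (hm : ∀ i j, m i j = m j i)
    (x : Fin n → Bool) :
    ∫ θ in Set.univ.pi (fun _ : Fin n => Set.Icc (0 : ℝ) (2 * Real.pi)),
      ((gsProb n m θ x ^ 2 : ℝ) : ℂ) =
      (1 / 2 ^ n : ℂ) ^ 4 * (2 ^ n * (2 * Real.pi) ^ n *
        ∑ L : Finset (Fin n), ∑ R : Finset (Fin n),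
          if Disjoint L R then (-1 : ℂ) ^ (∑ i ∈ L, ∑ j ∈ R, m i j) else 0) := by
  have h_int : ∀ f : (Fin n → ℝ) → ℂ, Continuous f → Integrable f (volume.restrict
      (Set.univ.pi (fun _ : Fin n => Set.Icc (0 : ℝ) (2 * Real.pi)))) := fun f hf =>
    hf.continuousOn.integrableOn_compact (isCompact_univ_pi fun _ => isCompact_Icc)
  simp only [gsProb_sq]
  rw [integral_const_mul, ← sum_balanced_gsSign hm x]
  congr 1
  rw [integral_finsetSum _ fun _ _ => h_int _ (by fun_prop)]
  refine Finset.sum_congr rfl fun z _ => ?_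
  rw [integral_finsetSum _ fun _ _ => h_int _ (by fun_prop)]
  refine Finset.sum_congr rfl fun w _ => ?_
  rw [integral_finsetSum _ fun _ _ => h_int _ (by fun_prop)]
  refine Finset.sum_congr rfl fun v _ => ?_
  rw [integral_finsetSum _ fun _ _ => h_int _ (by fun_prop)]
  refine Finset.sum_congr rfl fun u _ => ?_
  rw [integral_const_mul, setIntegral_prod_exp_int]

lemma continuous_gsProb {n : ℕ} (m : Fin n → Fin n → ℕ) (x : Fin n → Bool) :
    Continuous fun θ => gsProb n m θ x := by
  unfold gsProb gsAmp
  exact Complex.continuous_normSq.comp (by fun_prop)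

/-- The angle average of the second moment, for an arbitrary symmetric multiplicity function. -/
lemma avgSecondMoment_eq {n : ℕ} {m : Fin n → Fin n → ℕ} (hm : ∀ i j, m i j = m j i) :
    avgSecondMoment n m = (1 / 2 ^ n : ℝ) * ∑ L : Finset (Fin n), ∑ R : Finset (Fin n),
      if Disjoint L R then (-1 : ℝ) ^ (∑ i ∈ L, ∑ j ∈ R, m i j) else 0 := by
  set S : ℝ := ∑ L : Finset (Fin n), ∑ R : Finset (Fin n),
    if Disjoint L R then (-1 : ℝ) ^ (∑ i ∈ L, ∑ j ∈ R, m i j) else 0 with hS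
  have hx : ∀ x, ∫ θ in Set.univ.pi (fun _ : Fin n => Set.Icc (0 : ℝ) (2 * Real.pi)),
      gsProb n m θ x ^ 2 = (1 / 2 ^ n) ^ 4 * (2 ^ n * (2 * Real.pi) ^ n * S) := by
    intro x
    apply Complex.ofReal_injective
    rw [← integral_complex_ofReal, setIntegral_gsProb_sq hm x, hS]
    push_cast
    simp only [apply_ite ((↑) : ℝ → ℂ), Complex.ofReal_pow, Complex.ofReal_neg,
      Complex.ofReal_one, Complex.ofReal_zero]
  unfold avgSecondMoment secondMoment
  have h_int : ∀ x, IntegrableOn (fun θ => gsProb n m θ x ^ 2)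
      (Set.univ.pi (fun _ : Fin n => Set.Icc (0 : ℝ) (2 * Real.pi))) := fun x =>
    ((continuous_gsProb m x).pow 2).continuousOn.integrableOn_compact
      (isCompact_univ_pi fun _ => isCompact_Icc)
  rw [integral_const_mul, integral_finsetSum _ fun x _ => h_int x]
  simp only [hx, Finset.sum_const, Finset.card_univ, Fintype.card_fun, Fintype.card_bool,
    Fintype.card_fin, nsmul_eq_mul]
  have := Real.pi_pos
  push_cast
  field_simp

/-- the angle-average of the normalized second moment of the X-Y plane output
distribution of the graph state of a simple graph `G` equals the combinatorial sum
`2^{-n} Σ_{L,R ⊆ [n], L ∩ R = ∅} (−1)^{e_G(L,R)}`, where `e_G(L,R)` is the number of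
edges of `G` with one endpoint in `L` and the other in `R`. -/
theorem stmt_2 (n : ℕ) (G : SimpleGraph (Fin n)) [DecidableRel G.Adj] :
    avgSecondMoment n (fun i j => if G.Adj i j then 1 else 0) =
      (1 / 2 ^ n : ℝ) * ∑ L : Finset (Fin n), ∑ R : Finset (Fin n),
        if Disjoint L R then
          (-1 : ℝ) ^ (∑ i ∈ L, ∑ j ∈ R, if G.Adj i j then 1 else 0)
        else 0 := by
  have hm : ∀ i j, (fun i j => if G.Adj i j then 1 else 0 : Fin n → Fin n → ℕ) i j =
      (fun i j => if G.Adj i j then 1 else 0 : Fin n → Fin n → ℕ) j i := by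
    intro i j
    simp only [G.adj_comm]
  exact avgSecondMoment_eq hm
end
end
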